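/- Let N ≥ 1, α > −2, m > 0 and p > 1, let σ > −1, and let w : ℝ^N → ℝ be continuous, tending to 0 at infinity, integrable, and satisfying ∫_{ℝ^N} w(x) dx > 0. Then there is no global classical solution of u_t − Δu = |x|^α |u|^p + ζ(t) w(x); that is, there is no function u : [0,∞) × ℝ^N → ℝ which is continuous, is continuously differentiable in t and twice continuously differentiable in x on (0,∞) × (ℝ^N ∖ {0}), satisfies ∂_t u(t,x) − Δu(t,x) = |x|^α |u(t,x)|^p + ζ(t) w(x) for all t > 0 and all x ≠ 0, and for which (t,x) ↦ |x|^α |u(t,x)|^p and x ↦ |x|^{−α/(p−1)} are locally integrable. -/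

import Mathlib

open MeasureTheory Real Set Filter

/-- The forcing profile `ζ(t) = t^σ` for `0 < t < 1` and `ζ(t) = t^m` for `t ≥ 1`. -/
noncomputable def zeta (σ m t : ℝ) : ℝ := if t < 1 then t ^ σ else t ^ m

/-- `u` is a global classical solution of `u_t - Δu = |x|^α |u|^p + ζ(t) w(x)`:
it is continuous on `[0,∞) × ℝ^N`, continuously differentiable in `t` and twice
continuously differentiable in `x` on `(0,∞) × (ℝ^N \ {0})`, satisfies the
equation there, and `|x|^α |u|^p` and `|x|^{-α/(p-1)}` are locally integrable. -/
def IsGlobalClassicalSolution (N : ℕ) (α p σ m : ℝ)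
    (w : EuclideanSpace ℝ (Fin N) → ℝ)
    (u : ℝ → EuclideanSpace ℝ (Fin N) → ℝ) : Prop :=
  ContinuousOn (fun q : ℝ × EuclideanSpace ℝ (Fin N) => u q.1 q.2)
      (Set.Ici 0 ×ˢ Set.univ) ∧
  (∀ t : ℝ, 0 < t → ∀ x : EuclideanSpace ℝ (Fin N), x ≠ 0 →
      DifferentiableAt ℝ (fun s => u s x) t) ∧
  ContinuousOn (fun q : ℝ × EuclideanSpace ℝ (Fin N) => deriv (fun s => u s q.2) q.1)
      (Set.Ioi 0 ×ˢ {x | x ≠ 0}) ∧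
  (∀ t : ℝ, 0 < t → ContDiffOn ℝ 2 (u t) {x | x ≠ 0}) ∧
  (∀ t : ℝ, 0 < t → ∀ x : EuclideanSpace ℝ (Fin N), x ≠ 0 →
      deriv (fun s => u s x) t
        - ∑ i : Fin N, fderiv ℝ (fun y => fderiv ℝ (u t) y (EuclideanSpace.single i 1)) x
            (EuclideanSpace.single i 1)
        = ‖x‖ ^ α * |u t x| ^ p + zeta σ m t * w x) ∧
  LocallyIntegrableOn (fun q : ℝ × EuclideanSpace ℝ (Fin N) => ‖q.2‖ ^ α * |u q.1 q.2| ^ p)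
      (Set.Ici 0 ×ˢ Set.univ) ∧
  LocallyIntegrable (fun x : EuclideanSpace ℝ (Fin N) => ‖x‖ ^ (-(α / (p - 1))))

/-- The sum of the second derivatives of `g` along the vectors `v i`; it is the Laplacian when `v`
is an orthonormal basis. -/
noncomputable def sumSecondDeriv {E ι : Type*} [NormedAddCommGroup E] [NormedSpace ℝ E] [Fintype ι]
    (v : ι → E) (g : E → ℝ) (x : E) : ℝ :=
  ∑ i, fderiv ℝ (fun y => fderiv ℝ g y (v i)) x (v i)

theorem sumSecondDeriv_eq_zero_of_notMem_tsupport {E ι : Type*} [NormedAddCommGroup E]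
    [NormedSpace ℝ E] [Fintype ι] {v : ι → E} {f : E → ℝ} {x : E} (hx : x ∉ tsupport f) :
    sumSecondDeriv v f x = 0 :=
  Finset.sum_eq_zero fun i _ =>
    image_eq_zero_of_notMem_tsupport
      (f := fun x => fderiv ℝ (fun y => fderiv ℝ f y (v i)) x (v i)) fun h => hx
        (tsupport_fderiv_apply_subset ℝ _ (tsupport_fderiv_apply_subset ℝ _ h))

theorem continuousOn_sumSecondDeriv {E ι : Type*} [NormedAddCommGroup E]
    [NormedSpace ℝ E] [Fintype ι] (v : ι → E) {g : E → ℝ} {S : Set E} (hS : IsOpen S)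
    (hg : ContDiffOn ℝ 2 g S) : ContinuousOn (sumSecondDeriv v g) S :=
  continuousOn_finsetSum _ fun i _ =>
    (((hg.fderiv_of_isOpen hS (m := 1) (by norm_num)).clm_apply
      (contDiffOn_const (c := v i))).continuousOn_fderiv_of_isOpen hS le_rfl).clm_apply
        continuousOn_const

section CompactlySupportedCalculus

theorem continuous_mul_of_tsupport_subset {E : Type*} [TopologicalSpace E] {f g : E → ℝ}
    {S : Set E} (hS : IsOpen S) (hf : Continuous f) (hfS : tsupport f ⊆ S) (hg : ContinuousOn g S) :
    Continuous fun x => f x * g x :=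
  continuous_of_tsupport fun _ hx =>
    hf.continuousAt.mul (hg.continuousAt (hS.mem_nhds (hfS (tsupport_mul_subset_left hx))))

variable {E : Type*} [NormedAddCommGroup E] [MeasurableSpace E] [BorelSpace E] {μ : Measure E}

theorem integrable_mul_of_tsupport_subset [IsFiniteMeasureOnCompacts μ] {f g : E → ℝ} {S : Set E}
    (hS : IsOpen S) (hf : Continuous f) (hfc : HasCompactSupport f) (hfS : tsupport f ⊆ S)
    (hg : ContinuousOn g S) : Integrable (fun x => f x * g x) μ :=
  (continuous_mul_of_tsupport_subset hS hf hfS hg).integrable_of_hasCompactSupport hfc.mul_right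

theorem hasDerivAt_integral_mul_of_tsupport_subset [IsFiniteMeasureOnCompacts μ]
    {f : E → ℝ} {u u' : ℝ → E → ℝ} {S : Set E}
    (hS : IsOpen S) (hf : Continuous f) (hfc : HasCompactSupport f) (hfS : tsupport f ⊆ S)
    (hu : ∀ t, 0 < t → ContinuousOn (u t) S)
    (hu' : ∀ t, 0 < t → ∀ x ∈ S, HasDerivAt (fun s => u s x) (u' t x) t)
    (hu'c : ContinuousOn (fun q : ℝ × E => u' q.1 q.2) (Ioi 0 ×ˢ S)) {t : ℝ} (ht : 0 < t) :
    HasDerivAt (fun s => ∫ x, f x * u s x ∂μ) (∫ x, f x * u' t x ∂μ) t := by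
  have hslice : ∀ s, 0 < s → ContinuousOn (u' s) S := fun s hs =>
    hu'c.comp (by fun_prop : ContinuousOn (fun x : E => (s, x)) S) fun x hx => ⟨hs, hx⟩
  obtain ⟨C, hC⟩ := ((isCompact_Icc (a := t / 2) (b := 2 * t)).prod hfc).exists_bound_of_continuousOn
    (hu'c.mono (prod_mono (fun s hs => (half_pos ht).trans_le hs.1) hfS))
  refine (hasDerivAt_integral_of_dominated_loc_of_deriv_le (x₀ := t) (s := Ioo (t / 2) (2 * t))
    (F := fun s x => f x * u s x)
    (F' := fun s x => f x * u' s x) (bound := fun x => ‖f x‖ * C)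
    (Ioo_mem_nhds (by linarith) (by linarith)) ?_
    (integrable_mul_of_tsupport_subset hS hf hfc hfS (hu t ht))
    (integrable_mul_of_tsupport_subset hS hf hfc hfS (hslice t ht)).aestronglyMeasurable
    (.of_forall fun x s hs => ?_)
    ((hf.integrable_of_hasCompactSupport hfc).norm.mul_const C)
    (.of_forall fun x s hs => ?_)).2
  · filter_upwards [lt_mem_nhds ht] with s hs
    exact (integrable_mul_of_tsupport_subset hS hf hfc hfS (hu s hs)).aestronglyMeasurable
  · rw [norm_mul]
    by_cases hx : x ∈ tsupport f
    · exact mul_le_mul_of_nonneg_left (hC (s, x) ⟨⟨hs.1.le, hs.2.le⟩, hx⟩) (norm_nonneg _)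
    · simp [image_eq_zero_of_notMem_tsupport hx]
  · by_cases hx : x ∈ tsupport f
    · exact (hu' s ((half_pos ht).trans hs.1) x (hfS hx)).const_mul _
    · simpa [image_eq_zero_of_notMem_tsupport hx] using hasDerivAt_const s (0 : ℝ)

variable [NormedSpace ℝ E]

theorem integrable_sumSecondDeriv_mul [IsFiniteMeasureOnCompacts μ] {ι : Type*} [Fintype ι] (v : ι → E)
    {f g : E → ℝ} {S : Set E} (hS : IsOpen S) (hf : ContDiff ℝ 2 f)
    (hfc : HasCompactSupport f) (hfS : tsupport f ⊆ S) (hg : ContinuousOn g S) :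
    Integrable (fun x => sumSecondDeriv v f x * g x) μ := by
  have hsub : tsupport (sumSecondDeriv v f) ⊆ tsupport f :=
    closure_minimal (fun x hx => not_imp_comm.1 sumSecondDeriv_eq_zero_of_notMem_tsupport hx)
      (isClosed_tsupport f)
  exact integrable_mul_of_tsupport_subset hS
    (continuousOn_univ.1 (continuousOn_sumSecondDeriv v isOpen_univ hf.contDiffOn))
    (hfc.of_isClosed_subset (isClosed_tsupport _) hsub) (hsub.trans hfS) hg

variable [FiniteDimensional ℝ E] [μ.IsAddHaarMeasure]

theorem integral_mul_fderiv_eq_neg_of_tsupport_subset {f g : E → ℝ} {S : Set E}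
    (hS : IsOpen S) (hf : ContDiff ℝ 1 f) (hfc : HasCompactSupport f) (hfS : tsupport f ⊆ S)
    (hg : ContDiffOn ℝ 1 g S) (v : E) :
    ∫ x, f x * fderiv ℝ g x v ∂μ = -∫ x, fderiv ℝ f x v * g x ∂μ := by
  have hf' : Continuous fun x => fderiv ℝ f x v :=
    (hf.continuous_fderiv one_ne_zero).clm_apply continuous_const
  have hg' : ContinuousOn (fun x => fderiv ℝ g x v) S :=
    (hg.continuousOn_fderiv_of_isOpen hS le_rfl).clm_apply continuousOn_const
  refine integral_mul_fderiv_eq_neg_fderiv_mul_of_integrable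
    (integrable_mul_of_tsupport_subset hS hf' (hfc.fderiv_apply ℝ v)
      ((tsupport_fderiv_apply_subset ℝ v).trans hfS) hg.continuousOn)
    (integrable_mul_of_tsupport_subset hS hf.continuous hfc hfS hg')
    (integrable_mul_of_tsupport_subset hS hf.continuous hfc hfS hg.continuousOn)
    (fun x _ => (hf.differentiable one_ne_zero) x)
    (fun x hx => (hg.differentiableOn one_ne_zero).differentiableAt (hS.mem_nhds (hfS hx)))

theorem integral_mul_fderiv_fderiv_eq_of_tsupport_subset {f g : E → ℝ} {S : Set E}
    (hS : IsOpen S) (hf : ContDiff ℝ 2 f) (hfc : HasCompactSupport f) (hfS : tsupport f ⊆ S)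
    (hg : ContDiffOn ℝ 2 g S) (v : E) :
    ∫ x, f x * fderiv ℝ (fun y => fderiv ℝ g y v) x v ∂μ =
      ∫ x, fderiv ℝ (fun y => fderiv ℝ f y v) x v * g x ∂μ := by
  have hf' : ContDiff ℝ 1 fun x => fderiv ℝ f x v :=
    (hf.fderiv_right (m := 1) (by norm_num)).clm_apply contDiff_const
  have hg' : ContDiffOn ℝ 1 (fun x => fderiv ℝ g x v) S :=
    (hg.fderiv_of_isOpen hS (m := 1) (by norm_num)).clm_apply contDiffOn_const
  rw [integral_mul_fderiv_eq_neg_of_tsupport_subset hS (hf.of_le (by norm_num)) hfc hfS hg',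
    integral_mul_fderiv_eq_neg_of_tsupport_subset hS hf' (hfc.fderiv_apply ℝ v)
      ((tsupport_fderiv_apply_subset ℝ v).trans hfS) (hg.of_le (by norm_num)), neg_neg]

theorem integral_mul_sumSecondDeriv {ι : Type*} [Fintype ι] (v : ι → E) {f g : E → ℝ} {S : Set E}
    (hS : IsOpen S) (hf : ContDiff ℝ 2 f) (hfc : HasCompactSupport f) (hfS : tsupport f ⊆ S)
    (hg : ContDiffOn ℝ 2 g S) :
    ∫ x, f x * sumSecondDeriv v g x ∂μ = ∫ x, sumSecondDeriv v f x * g x ∂μ := by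
  have h1 : ∀ i, Integrable (fun x => f x * fderiv ℝ (fun y => fderiv ℝ g y (v i)) x (v i)) μ :=
    fun i => by
      simpa [sumSecondDeriv] using integrable_mul_of_tsupport_subset (μ := μ) hS hf.continuous hfc hfS
        (continuousOn_sumSecondDeriv (fun _ : Unit => v i) hS hg)
  have h2 : ∀ i, Integrable (fun x => fderiv ℝ (fun y => fderiv ℝ f y (v i)) x (v i) * g x) μ :=
    fun i => by
      simpa [sumSecondDeriv] using integrable_sumSecondDeriv_mul (μ := μ) (fun _ : Unit => v i)
        hS hf hfc hfS hg.continuousOn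
  simp_rw [sumSecondDeriv, Finset.mul_sum, Finset.sum_mul]
  rw [integral_finsetSum _ fun i _ => h1 i, integral_finsetSum _ fun i _ => h2 i]
  exact Finset.sum_congr rfl fun i _ =>
    integral_mul_fderiv_fderiv_eq_of_tsupport_subset hS hf hfc hfS hg (v i)

end CompactlySupportedCalculus

/-- On a finite-dimensional inner product space, a smooth bump function raised to a high power has second
derivatives controlled by a fractional power of itself. -/
theorem exists_cutoff_abs_sumSecondDeriv_le {E ι : Type*} [NormedAddCommGroup E]
    [InnerProductSpace ℝ E] [FiniteDimensional ℝ E] [Fintype ι] (v : ι → E) {p : ℝ} (hp : 1 < p)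
    {S : Set E} (hS : IsOpen S) {x₀ : E} (hx₀ : x₀ ∈ S) :
    ∃ f : E → ℝ, ContDiff ℝ 2 f ∧ HasCompactSupport f ∧ tsupport f ⊆ S ∧ (∀ x, 0 ≤ f x) ∧
      0 < f x₀ ∧ ∃ C, 0 ≤ C ∧ ∀ x,
        |sumSecondDeriv v f x| ≤ C * f x ^ p⁻¹ := by
  obtain ⟨r, hr, hrS⟩ := Metric.nhds_basis_closedBall.mem_iff.1 (hS.mem_nhds hx₀)
  let χ : ContDiffBump x₀ := ⟨r / 2, r, half_pos hr, half_lt_self hr⟩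
  have hχ : ContDiff ℝ 2 χ := χ.contDiff
  have hχ' : ∀ i, ContDiff ℝ 1 fun y => fderiv ℝ χ y (v i) := fun i =>
    (hχ.fderiv_right (m := 1) (by norm_num)).clm_apply contDiff_const
  obtain ⟨n, hn⟩ := exists_nat_ge (2 / (p - 1))
  have hp0 : 0 < p := one_pos.trans hp
  have hnp : ((n + 2 : ℕ) : ℝ) * p⁻¹ ≤ n := by
    rw [div_le_iff₀ (by linarith)] at hn
    rw [mul_inv_le_iff₀ hp0]
    push_cast
    linarith
  have hsupp : tsupport (fun x => χ x ^ (n + 2)) ⊆ tsupport χ :=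
    closure_mono fun x hx h => hx (by simp [h])
  have hfst : ∀ i y, fderiv ℝ (fun x => χ x ^ (n + 2)) y (v i) =
      (n + 2) * χ y ^ (n + 1) * fderiv ℝ χ y (v i) := fun i y => by
    have h := ((hχ.differentiable two_ne_zero) y).hasFDerivAt.pow (n + 2)
    rw [h.fderiv]
    simp
  let H : E → ℝ := fun x => ∑ i, ((n + 2) * (n + 1) * fderiv ℝ χ x (v i) ^ 2 +
    (n + 2) * χ x * fderiv ℝ (fun y => fderiv ℝ χ y (v i)) x (v i))
  have hsnd : ∀ x, sumSecondDeriv v (fun x => χ x ^ (n + 2)) x = χ x ^ n * H x := fun x => by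
    rw [sumSecondDeriv, Finset.mul_sum]
    refine Finset.sum_congr rfl fun i _ => ?_
    simp_rw [hfst]
    have h := ((((hχ.differentiable two_ne_zero) x).hasFDerivAt.pow (n + 1)).const_mul
      ((n : ℝ) + 2)).mul (((hχ' i).differentiable one_ne_zero) x).hasFDerivAt
    refine (congrArg (fun T => T (v i)) h.fderiv).trans ?_
    simp
    ring
  have hHc : Continuous H := by
    refine continuous_finsetSum _ fun i _ => ?_
    have h1 := (hχ' i).continuous
    have h2 : Continuous fun x => fderiv ℝ (fun y => fderiv ℝ χ y (v i)) x (v i) :=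
      ((hχ' i).continuous_fderiv one_ne_zero).clm_apply continuous_const
    have h3 := hχ.continuous
    fun_prop
  have hHs : HasCompactSupport H := by
    refine HasCompactSupport.of_support_subset_isCompact χ.hasCompactSupport fun x hx => ?_
    by_contra hx'
    refine hx (Finset.sum_eq_zero fun i _ => ?_)
    have h1 : fderiv ℝ χ x (v i) = 0 :=
      image_eq_zero_of_notMem_tsupport (f := fun x => fderiv ℝ χ x (v i)) fun h =>
        hx' (tsupport_fderiv_apply_subset ℝ (v i) h)
    simp [h1, image_eq_zero_of_notMem_tsupport hx']
  obtain ⟨C, hC⟩ := hHs.exists_bound_of_continuous hHc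
  refine ⟨fun x => χ x ^ (n + 2), hχ.pow _,
    χ.hasCompactSupport.of_isClosed_subset (isClosed_tsupport _) hsupp,
    hsupp.trans (χ.tsupport_eq ▸ hrS), fun x => pow_nonneg χ.nonneg _,
    pow_pos (χ.pos_of_mem_ball (Metric.mem_ball_self hr)) _, C,
    (norm_nonneg _).trans (hC x₀), fun x => ?_⟩
  rw [hsnd, abs_mul, abs_of_nonneg (pow_nonneg χ.nonneg n), mul_comm,
    ← Real.rpow_natCast_mul χ.nonneg]
  have h1 : χ x ^ n ≤ χ x ^ (((n + 2 : ℕ) : ℝ) * p⁻¹) := by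
    rw [← Real.rpow_natCast (χ x) n]
    exact Real.rpow_le_rpow_of_exponent_ge' χ.nonneg χ.le_one (by positivity) hnp
  exact mul_le_mul (hC x) h1 (pow_nonneg χ.nonneg n) ((norm_nonneg _).trans (hC x₀))

theorem mul_rpow_sub_one_le {p s A : ℝ} (hp : 1 < p) (hs : 0 ≤ s) (hA : 0 ≤ A) :
    p * A ^ (p - 1) * s ≤ s ^ p + (p - 1) * A ^ p := by
  have hp1 : 0 < p - 1 := by linarith
  have hpq : p.HolderConjugate (p / (p - 1)) := Real.HolderConjugate.conjExponent hp
  have h := Real.young_inequality_of_nonneg hs (Real.rpow_nonneg hA (p - 1)) hpq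
  rw [← Real.rpow_mul hA, mul_div_cancel₀ _ hp1.ne'] at h
  have h2 := mul_le_mul_of_nonneg_left h (by linarith : 0 ≤ p)
  have h3 : p * (s ^ p / p + A ^ p / (p / (p - 1))) = s ^ p + (p - 1) * A ^ p := by
    field_simp
  linarith

theorem exists_mul_le_mul_rpow_add {p c ε : ℝ} (hp : 1 < p) (hc : 0 ≤ c) (hε : 0 < ε) :
    ∃ K, ∀ s, 0 ≤ s → c * s ≤ ε * s ^ p + K := by
  have hp1 : 0 < p - 1 := by linarith
  have hb : 0 ≤ c / (ε * p) := by positivity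
  have hA : 0 ≤ (c / (ε * p)) ^ (p - 1)⁻¹ := Real.rpow_nonneg hb _
  refine ⟨ε * ((p - 1) * ((c / (ε * p)) ^ (p - 1)⁻¹) ^ p), fun s hs => ?_⟩
  have h := mul_le_mul_of_nonneg_left (mul_rpow_sub_one_le hp hs hA) hε.le
  rw [Real.rpow_inv_rpow hb hp1.ne'] at h
  have h2 : ε * (p * (c / (ε * p)) * s) = c * s := by
    field_simp
  linarith

/-- A differential inequality with superlinear growth and forcing `t ^ m`, `m > 0`, has no global
solution. -/
theorem false_of_superlinear_differential_inequality {p m δ c C : ℝ} (hp : 1 < p) (hm : 0 < m)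
    (hδ : 0 < δ) (hc : 0 < c) {F F' : ℝ → ℝ}
    (hF : ∀ t, 1 ≤ t → HasDerivAt F (F' t) t)
    (hlow : ∀ t, 1 ≤ t → c * t ^ m - C ≤ F' t)
    (hpow : ∀ t, 1 ≤ t → 0 ≤ F t → δ * F t ^ p + c * t ^ m - C ≤ F' t) : False := by
  obtain ⟨T, hT1, hT⟩ : ∃ T, 1 ≤ T ∧ ∀ t, T ≤ t → 1 ≤ c * t ^ m - C := by
    have h : Tendsto (fun t : ℝ => c * t ^ m - C) atTop atTop :=
      tendsto_atTop_add_const_right _ _ ((tendsto_rpow_atTop hm).const_mul_atTop hc)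
    obtain ⟨T, hT⟩ := eventually_atTop.1 (h.eventually_ge_atTop 1)
    exact ⟨max T 1, le_max_right _ _, fun t ht => hT t ((le_max_left _ _).trans ht)⟩
  have hcont : ContinuousOn F (Ici T) := fun t ht =>
    (hF t (hT1.trans ht)).continuousAt.continuousWithinAt
  have hgrow : ∀ t, T ≤ t → t - T ≤ F t - F T := fun t ht => by
    have h := (convex_Ici T).mul_sub_le_image_sub_of_le_deriv (C := 1) hcont
      (fun s hs => by
        rw [interior_Ici] at hs
        exact (hF s (hT1.trans (le_of_lt hs))).differentiableAt.differentiableWithinAt)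
      (fun s hs => by
        rw [interior_Ici] at hs
        rw [(hF s (hT1.trans (le_of_lt hs))).deriv]
        exact (hT s (le_of_lt hs)).trans (hlow s (hT1.trans (le_of_lt hs))))
      T self_mem_Ici t ht ht
    linarith
  obtain ⟨T₂, hT₂, hpos⟩ : ∃ T₂, T ≤ T₂ ∧ ∀ t, T₂ ≤ t → 0 < F t :=
    ⟨T + |F T| + 1, by linarith [abs_nonneg (F T)], fun t ht => by
      linarith [hgrow t (by linarith [abs_nonneg (F T)]), neg_abs_le (F T)]⟩
  have hderiv : ∀ t, T₂ ≤ t → HasDerivAt (fun s => -F s ^ (1 - p))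
      (-(F' t * (1 - p) * F t ^ (1 - p - 1))) t := fun t ht =>
    ((hF t (hT1.trans (hT₂.trans ht))).rpow_const (Or.inl (hpos t ht).ne')).neg
  have hbound : ∀ t, T₂ ≤ t → (p - 1) * δ ≤ -(F' t * (1 - p) * F t ^ (1 - p - 1)) := fun t ht => by
    have hF' : δ * F t ^ p ≤ F' t := by
      linarith [hpow t (hT1.trans (hT₂.trans ht)) (hpos t ht).le, hT t (hT₂.trans ht)]
    have h1 : F t ^ p * F t ^ (1 - p - 1) = 1 := by
      rw [← Real.rpow_add (hpos t ht)]
      ring_nf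
      exact Real.rpow_zero _
    calc (p - 1) * δ = (p - 1) * (δ * F t ^ p) * F t ^ (1 - p - 1) := by
          linear_combination -((p - 1) * δ) * h1
      _ ≤ (p - 1) * F' t * F t ^ (1 - p - 1) :=
          mul_le_mul_of_nonneg_right (mul_le_mul_of_nonneg_left hF' (by linarith))
            (Real.rpow_nonneg (hpos t ht).le _)
      _ = _ := by ring
  have hlin : ∀ t, T₂ ≤ t → (p - 1) * δ * (t - T₂) ≤ F T₂ ^ (1 - p) := fun t ht => by
    have h := (convex_Ici T₂).mul_sub_le_image_sub_of_le_deriv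
      (fun s hs => (hderiv s hs).continuousAt.continuousWithinAt)
      (fun s hs => by
        rw [interior_Ici] at hs
        exact (hderiv s (le_of_lt hs)).differentiableAt.differentiableWithinAt)
      (fun s hs => by
        rw [interior_Ici] at hs
        rw [(hderiv s (le_of_lt hs)).deriv]
        exact hbound s (le_of_lt hs))
      T₂ self_mem_Ici t ht ht
    linarith [Real.rpow_nonneg (hpos t ht).le (1 - p)]
  have hpδ : 0 < (p - 1) * δ := mul_pos (by linarith) hδ
  have hq : 0 ≤ F T₂ ^ (1 - p) := Real.rpow_nonneg (hpos T₂ le_rfl).le _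
  have h := hlin (T₂ + (F T₂ ^ (1 - p) / ((p - 1) * δ) + 1)) (by
    have := div_nonneg hq hpδ.le
    linarith)
  rw [add_sub_cancel_left, mul_add, mul_div_cancel₀ _ hpδ.ne'] at h
  linarith

theorem exists_ne_pos_of_integral_pos {E : Type*} [MeasurableSpace E] {μ : Measure E}
    [NullSingletonClass μ] {w : E → ℝ} (a : E) (hw : 0 < ∫ x, w x ∂μ) : ∃ x, x ≠ a ∧ 0 < w x := by
  by_contra! h
  refine hw.not_ge (integral_nonpos_of_ae ?_)
  filter_upwards [Measure.ae_ne μ a] with x hx using h x hx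

/-- Blow-up for `N ≥ 1`, `m > 0` and `p > 1`:
if `∫ w > 0` then there is no global classical solution. -/
theorem stmt_11 (N : ℕ) (hN : 1 ≤ N) (α m p σ : ℝ) (hα : -2 < α) (hm : 0 < m)
    (hp : 1 < p) (hσ : -1 < σ)
    (w : EuclideanSpace ℝ (Fin N) → ℝ) (hwc : Continuous w)
    (hw0 : Tendsto w (cocompact _) (nhds 0))
    (hwi : Integrable w) (hwpos : 0 < ∫ x, w x) :
    ¬ ∃ u : ℝ → EuclideanSpace ℝ (Fin N) → ℝ,
        IsGlobalClassicalSolution N α p σ m w u := by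
  rintro ⟨u, hucont, hudiff, hu'cont, huC2, heq, -, -⟩
  have : Nonempty (Fin N) := ⟨⟨0, hN⟩⟩
  obtain ⟨x₀, hx₀, hwx₀⟩ := exists_ne_pos_of_integral_pos 0 hwpos
  have hSo : IsOpen {x : EuclideanSpace ℝ (Fin N) | x ≠ 0} := isOpen_ne
  let e : Fin N → EuclideanSpace ℝ (Fin N) := fun i => EuclideanSpace.single i 1
  obtain ⟨f, hf, hfc, hfS, hf0, hfx₀, D, hD0, hD⟩ :=
    exists_cutoff_abs_sumSecondDeriv_le e hp
      (hSo.inter (isOpen_lt continuous_const hwc)) ⟨hx₀, hwx₀⟩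
  have hfS0 : tsupport f ⊆ {x | x ≠ 0} := hfS.trans inter_subset_left
  have hfw : ∀ x, 0 ≤ f x * w x := fun x => by
    by_cases hx : x ∈ tsupport f
    · exact mul_nonneg (hf0 x) (le_of_lt (hfS hx).2)
    · simp [image_eq_zero_of_notMem_tsupport hx]
  have hfwi : Integrable fun x => f x * w x :=
    integrable_mul_of_tsupport_subset isOpen_univ hf.continuous hfc (subset_univ _) hwc.continuousOn
  have hc : 0 < ∫ x, f x * w x :=
    (hf.continuous.mul hwc).integral_pos_of_hasCompactSupport_nonneg_nonzero hfc.mul_right hfw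
      (mul_pos hfx₀ hwx₀).ne'
  have hfi : Integrable f := hf.continuous.integrable_of_hasCompactSupport hfc
  have hI : 0 < ∫ x, f x :=
    hf.continuous.integral_pos_of_hasCompactSupport_nonneg_nonzero hfc hf0 hfx₀.ne'
  have hα_cont : ContinuousOn (fun x : EuclideanSpace ℝ (Fin N) => ‖x‖ ^ α) {x | x ≠ 0} :=
    continuous_norm.continuousOn.rpow_const fun x hx => Or.inl (norm_ne_zero_iff.2 hx)
  obtain ⟨a, ha, hα_low⟩ : ∃ a, 0 < a ∧ ∀ x ∈ tsupport f, a ≤ ‖x‖ ^ α := by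
    obtain ⟨z, hz, hzmin⟩ := hfc.isCompact.exists_isMinOn ⟨x₀, subset_closure hfx₀.ne'⟩
      (hα_cont.mono hfS0)
    exact ⟨‖z‖ ^ α, Real.rpow_pos_of_pos (norm_pos_iff.2 (hfS0 hz)) _, fun x hx => hzmin hx⟩
  obtain ⟨K, hK⟩ := exists_mul_le_mul_rpow_add hp hD0 (half_pos ha)
  have hp0 : 0 < p := one_pos.trans hp
  have hpoint : ∀ A, 0 ≤ A → ∀ s x,
      a / 2 * (p * A ^ (p - 1)) * (f x * s) - a / 2 * (p - 1) * A ^ p * f x -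
        (tsupport f).indicator (fun _ => K) x ≤ f x * (‖x‖ ^ α * |s| ^ p) + sumSecondDeriv e f x * s := by
    intro A hA s x
    by_cases hx : x ∈ tsupport f
    · rw [indicator_of_mem hx]
      have h1 : -(D * (|s| * f x ^ p⁻¹)) ≤ sumSecondDeriv e f x * s := by
        refine (neg_le_neg ?_).trans (neg_abs_le _)
        rw [abs_mul]
        calc |sumSecondDeriv e f x| * |s| ≤ D * f x ^ p⁻¹ * |s| :=
              mul_le_mul_of_nonneg_right (hD x) (abs_nonneg s)
          _ = _ := by ring
      have h2 := hK (|s| * f x ^ p⁻¹) (mul_nonneg (abs_nonneg s) (Real.rpow_nonneg (hf0 x) _))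
      rw [Real.mul_rpow (abs_nonneg s) (Real.rpow_nonneg (hf0 x) _),
        Real.rpow_inv_rpow (hf0 x) hp0.ne'] at h2
      have h3 : a * (f x * |s| ^ p) ≤ f x * (‖x‖ ^ α * |s| ^ p) := by
        calc a * (f x * |s| ^ p) ≤ ‖x‖ ^ α * (f x * |s| ^ p) :=
              mul_le_mul_of_nonneg_right (hα_low x hx)
                (mul_nonneg (hf0 x) (Real.rpow_nonneg (abs_nonneg s) _))
          _ = _ := by ring
      have h4 : p * A ^ (p - 1) * s ≤ |s| ^ p + (p - 1) * A ^ p :=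
        (mul_le_mul_of_nonneg_left (le_abs_self s)
          (mul_nonneg hp0.le (Real.rpow_nonneg hA _))).trans
          (mul_rpow_sub_one_le hp (abs_nonneg s) hA)
      have h5 := mul_le_mul_of_nonneg_left h4 (mul_nonneg (half_pos ha).le (hf0 x))
      linarith
    · have h1 : sumSecondDeriv e f x = 0 := sumSecondDeriv_eq_zero_of_notMem_tsupport hx
      simp [h1, hx, image_eq_zero_of_notMem_tsupport hx]
  have hu_slice : ∀ t, 0 < t → Continuous (u t) := fun t ht =>
    continuousOn_univ.1 (hucont.comp (by fun_prop : ContinuousOn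
      (fun x : EuclideanSpace ℝ (Fin N) => (t, x)) univ) fun x _ => ⟨ht.le, mem_univ x⟩)
  have hderiv : ∀ t, 0 < t → HasDerivAt (fun s => ∫ x, f x * u s x)
      (∫ x, f x * deriv (fun s => u s x) t) t := fun t ht =>
    hasDerivAt_integral_mul_of_tsupport_subset (u' := fun t x => deriv (fun s => u s x) t)
      hSo hf.continuous hfc hfS0 (fun s hs => (hu_slice s hs).continuousOn)
      (fun s hs x hx => (hudiff s hs x hx).hasDerivAt) hu'cont ht
  have hKi : Integrable ((tsupport f).indicator fun _ => K) :=
    (integrable_indicator_iff (isClosed_tsupport f).measurableSet).2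
      (integrableOn_const hfc.measure_lt_top.ne)
  have hkey : ∀ t, 1 ≤ t → ∀ A, 0 ≤ A →
      a / 2 * (p * A ^ (p - 1)) * (∫ x, f x * u t x) - a / 2 * (p - 1) * A ^ p * (∫ x, f x) -
        (∫ x, (tsupport f).indicator (fun _ => K) x) + t ^ m * ∫ x, f x * w x ≤
      ∫ x, f x * deriv (fun s => u s x) t := by
    intro t ht A hA
    have ht0 : 0 < t := one_pos.trans_le ht
    have hgreen := integral_mul_sumSecondDeriv (μ := volume) e hSo hf hfc hfS0 (huC2 t ht0)
    have hLui : Integrable fun x => f x * sumSecondDeriv e (u t) x :=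
      integrable_mul_of_tsupport_subset hSo hf.continuous hfc hfS0
        (continuousOn_sumSecondDeriv e hSo (huC2 t ht0))
    have hLfui : Integrable fun x => sumSecondDeriv e f x * u t x :=
      integrable_sumSecondDeriv_mul e hSo hf hfc hfS0 (hu_slice t ht0).continuousOn
    have hNi : Integrable fun x => f x * (‖x‖ ^ α * |u t x| ^ p) :=
      integrable_mul_of_tsupport_subset hSo hf.continuous hfc hfS0
        (hα_cont.mul ((hu_slice t ht0).abs.rpow_const fun _ => Or.inr hp0.le).continuousOn)
    have hfui : Integrable fun x => f x * u t x :=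
      integrable_mul_of_tsupport_subset isOpen_univ hf.continuous hfc (subset_univ _)
        (hu_slice t ht0).continuousOn
    have hpde : ∀ x, f x * deriv (fun s => u s x) t =
        f x * sumSecondDeriv e (u t) x + f x * (‖x‖ ^ α * |u t x| ^ p) + t ^ m * (f x * w x) := fun x => by
      by_cases hx : x ∈ tsupport f
      · have h := heq t ht0 x (hfS0 hx)
        rw [zeta, if_neg ht.not_gt] at h
        rw [sub_eq_iff_eq_add.1 h]
        simp only [sumSecondDeriv, e]
        ring
      · simp [image_eq_zero_of_notMem_tsupport hx]
    have hrhs : ∫ x, f x * deriv (fun s => u s x) t =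
        (∫ x, (f x * (‖x‖ ^ α * |u t x| ^ p) + sumSecondDeriv e f x * u t x)) +
          t ^ m * ∫ x, f x * w x := by
      have hsum : Integrable fun x =>
          f x * sumSecondDeriv e (u t) x + f x * (‖x‖ ^ α * |u t x| ^ p) := hLui.add hNi
      simp_rw [hpde]
      rw [integral_add hsum (hfwi.const_mul _), integral_add hLui hNi, hgreen,
        integral_add hNi hLfui, integral_const_mul]
      ring
    have hdiff : Integrable fun x => a / 2 * (p * A ^ (p - 1)) * (f x * u t x) -
        a / 2 * (p - 1) * A ^ p * f x := (hfui.const_mul _).sub (hfi.const_mul _)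
    have hmono := integral_mono (hdiff.sub hKi) (hNi.add hLfui) fun x => hpoint A hA (u t x) x
    simp only [Pi.add_apply, Pi.sub_apply] at hmono
    rw [integral_sub hdiff hKi, integral_sub (hfui.const_mul _) (hfi.const_mul _),
      integral_const_mul, integral_const_mul] at hmono
    rw [hrhs]
    linarith
  refine false_of_superlinear_differential_inequality hp hm
    (δ := a / 2 * (∫ x, f x) ^ (1 - p)) (c := ∫ x, f x * w x)
    (C := ∫ x, (tsupport f).indicator (fun _ => K) x)
    (mul_pos (half_pos ha) (Real.rpow_pos_of_pos hI _)) hc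
    (fun t ht => hderiv t (one_pos.trans_le ht)) (fun t ht => ?_) (fun t ht hFt => ?_)
  · have h := hkey t ht 0 le_rfl
    rw [Real.zero_rpow (by linarith), Real.zero_rpow hp0.ne'] at h
    linarith
  · have h := hkey t ht ((∫ x, f x * u t x) / ∫ x, f x) (div_nonneg hFt hI.le)
    refine le_trans (le_of_eq ?_) h
    set F := ∫ x, f x * u t x
    set I := ∫ x, f x
    have h1 : (F / I) ^ (p - 1) * F = F ^ p * I ^ (1 - p) := by
      rw [Real.div_rpow hFt hI.le, div_mul_eq_mul_div, ← Real.rpow_add_one' hFt (by linarith),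
        sub_add_cancel, div_eq_mul_inv, ← Real.rpow_neg hI.le, neg_sub]
    have h2 : (F / I) ^ p * I = F ^ p * I ^ (1 - p) := by
      rw [Real.div_rpow hFt hI.le, Real.rpow_sub hI, Real.rpow_one]
      ring
    linear_combination -(a / 2 * p) * h1 + a / 2 * (p - 1) * h2
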